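/- Let n, k ∈ ℕ, let 1 < p ≤ q < ∞ with 0 ≤ 1/p − 1/q ≤ 1/n, let η > 0, and let R > exp^{k+1}(1). Then there exists a constant C > 0 such that for every u ∈ C_c^∞(B_η∖{0}), ∫_{B_η} |∇u(x)|^p w_{k,1}(|x|)^{p−1} |x|^{1−n} dx ≥ C · ( ∫_{B_η} |u(x)|^q |x|^{1−n} / ( w_{k,1}(|x|) · (log^{k+1}(Rη/|x|))^{1+q/p'} ) dx )^{p/q}. -/

import Mathlib

open Real MeasureTheory Filter Topology Set

/-- The weight `w_{k,α}(t) = t · (∏_{j=1}^{k-1} log^j(Rη/t)) · (log^k(Rη/t))^α`, where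
`log^j` is the `j`-fold iterated logarithm. -/
noncomputable def wlog (k : ℕ) (α R η t : ℝ) : ℝ :=
  t * (∏ j ∈ Finset.Ico 1 k, Real.log^[j] (R * η / t)) * (Real.log^[k] (R * η / t)) ^ α

section aux
variable {n : ℕ}

/-- data: `v` is C^1, compactly supported away from the origin -/
structure Good (v : EuclideanSpace ℝ (Fin n) → ℝ) : Prop where
  cd : ContDiff ℝ 1 v
  cs : HasCompactSupport v
  z : v =ᶠ[𝓝 0] 0

lemma Good.v0 {v : EuclideanSpace ℝ (Fin n) → ℝ} (h : Good v) : v 0 = 0 := h.z.eq_of_nhds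

lemma wp_zero {v : EuclideanSpace ℝ (Fin n) → ℝ} (h : Good v) {γ : ℝ} (hγ : 0 < γ) (b : ℝ) :
    (fun y => |v y| ^ γ * ‖y‖ ^ b) =ᶠ[𝓝 0] 0 := by
  filter_upwards [h.z] with y hy
  simp [hy, Real.zero_rpow hγ.ne']

lemma wp_cs {v : EuclideanSpace ℝ (Fin n) → ℝ} (h : Good v) {γ : ℝ} (hγ : 0 < γ) (b : ℝ) :
    HasCompactSupport (fun y => |v y| ^ γ * ‖y‖ ^ b) := by
  refine h.cs.mono ?_
  intro y hy
  contrapose! hy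
  simp only [Function.mem_support, not_not] at hy ⊢
  simp [hy, Real.zero_rpow hγ.ne']

lemma wp_cont {v : EuclideanSpace ℝ (Fin n) → ℝ} (h : Good v) {γ : ℝ} (hγ : 0 < γ) (b : ℝ) :
    Continuous (fun y => |v y| ^ γ * ‖y‖ ^ b) := by
  rw [continuous_iff_continuousAt]
  intro y
  by_cases hy : y = 0
  · subst hy
    exact (continuousAt_const (y := (0:ℝ))).congr (wp_zero h hγ b).symm
  · have h1 : ContinuousAt v y := h.cd.continuous.continuousAt
    refine ContinuousAt.mul (h1.abs.rpow_const (Or.inr hγ.le)) ?_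
    exact continuous_norm.continuousAt.rpow_const (Or.inl (by simpa using hy))

lemma wp_hasFDerivAt {v : EuclideanSpace ℝ (Fin n) → ℝ} (h : Good v) {γ : ℝ} (hγ : 1 < γ) (b : ℝ)
    {y : EuclideanSpace ℝ (Fin n)} (hy : y ≠ 0) :
    HasFDerivAt (fun y => |v y| ^ γ * ‖y‖ ^ b)
      ((|v y| ^ γ) • ((b * ‖y‖ ^ (b - 2)) • innerSL ℝ y)
        + (‖y‖ ^ b) • fderiv ℝ (fun x => ‖v x‖ ^ γ) y) y := by
  have h1 : HasFDerivAt (fun x => |v x| ^ γ) (fderiv ℝ (fun x => ‖v x‖ ^ γ) y) y :=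
    ((h.cd.norm_rpow hγ).differentiable one_ne_zero y).hasFDerivAt
  have h2 : HasFDerivAt (fun y : EuclideanSpace ℝ (Fin n) => ‖y‖ ^ b)
      ((b * ‖y‖ ^ (b - 2)) • innerSL ℝ y) y := by
    have h3 : HasFDerivAt (fun y : EuclideanSpace ℝ (Fin n) => ‖y‖ ^ 2) (2 • innerSL ℝ y) y :=
      (hasStrictFDerivAt_norm_sq y).hasFDerivAt
    have h4 := h3.rpow_const (p := b / 2) (Or.inl (by simpa using hy))
    have hpos : 0 < ‖y‖ := norm_pos_iff.2 hy
    have e1 : (fun y : EuclideanSpace ℝ (Fin n) => (‖y‖ ^ 2) ^ (b / 2)) = fun y => ‖y‖ ^ b := by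
      funext z
      rw [← Real.rpow_natCast, ← Real.rpow_mul (norm_nonneg _)]
      congr 1; push_cast; ring
    rw [e1] at h4
    convert! h4 using 1
    rw [two_nsmul, ← two_smul ℝ, smul_smul]
    congr 1
    rw [← Real.rpow_natCast, ← Real.rpow_mul (norm_nonneg _)]
    rw [show ((2:ℕ):ℝ) * (b / 2 - 1) = b - 2 by push_cast; ring]
    ring
  exact h1.mul h2

lemma wp_cd {v : EuclideanSpace ℝ (Fin n) → ℝ} (h : Good v) {γ : ℝ} (hγ : 1 < γ) (b : ℝ) :
    ContDiff ℝ 1 (fun y => |v y| ^ γ * ‖y‖ ^ b) := by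
  rw [contDiff_iff_contDiffAt]
  intro y
  by_cases hy : y = 0
  · subst hy
    exact (contDiffAt_const (c := (0:ℝ))).congr_of_eventuallyEq (wp_zero h (by linarith) b)
  · refine ContDiffAt.mul (h.cd.norm_rpow hγ).contDiffAt ?_
    exact (contDiffAt_norm ℝ hy).rpow_const_of_ne (by simpa using hy)

lemma wp_fderiv_apply {v : EuclideanSpace ℝ (Fin n) → ℝ} (h : Good v) {γ : ℝ} (hγ : 1 < γ) (b : ℝ)
    (y : EuclideanSpace ℝ (Fin n)) :
    |fderiv ℝ (fun y => |v y| ^ γ * ‖y‖ ^ b) y y - b * (|v y| ^ γ * ‖y‖ ^ b)|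
      ≤ γ * (|v y| ^ (γ - 1) * ‖fderiv ℝ v y‖ * ‖y‖ ^ (b + 1)) := by
  by_cases hy : y = 0
  · subst hy
    simp [h.v0, Real.zero_rpow (by linarith : γ ≠ 0), Real.zero_rpow (by linarith : γ - 1 ≠ 0)]
  have hpos : 0 < ‖y‖ := norm_pos_iff.2 hy
  rw [(wp_hasFDerivAt h hγ b hy).fderiv]
  have h1 := norm_fderiv_norm_rpow_le (h.cd.differentiable one_ne_zero) (x := y) hγ
  have h2 := (fderiv ℝ (fun x => ‖v x‖ ^ γ) y).le_opNorm y
  simp only [add_apply, smul_apply, innerSL_apply_apply,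
    real_inner_self_eq_norm_sq, smul_eq_mul]
  have e : ‖y‖ ^ b = ‖y‖ ^ (b - 2) * ‖y‖ ^ 2 := by
    rw [← Real.rpow_natCast, ← Real.rpow_add hpos]; congr 1; push_cast; ring
  have e2 : ‖y‖ ^ (b + 1) = ‖y‖ ^ b * ‖y‖ := Real.rpow_add_one hpos.ne' _
  have : |v y| ^ γ * (b * ‖y‖ ^ (b - 2) * ‖y‖ ^ 2) + ‖y‖ ^ b * (fderiv ℝ (fun x => ‖v x‖ ^ γ) y) y
      - b * (|v y| ^ γ * ‖y‖ ^ b) = ‖y‖ ^ b * (fderiv ℝ (fun x => ‖v x‖ ^ γ) y) y := by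
    rw [e]; ring
  rw [this, abs_mul, abs_of_nonneg (Real.rpow_nonneg hpos.le b), e2]
  calc _ ≤ ‖y‖ ^ b * ((γ * ‖v y‖ ^ (γ - 1) * ‖fderiv ℝ v y‖) * ‖y‖) := by
        gcongr
        exact h2.trans (by gcongr)
    _ = _ := by rw [Real.norm_eq_abs]; ring

lemma wp_fderiv_norm {v : EuclideanSpace ℝ (Fin n) → ℝ} (h : Good v) {γ : ℝ} (hγ : 1 < γ) (b : ℝ)
    (y : EuclideanSpace ℝ (Fin n)) :
    ‖fderiv ℝ (fun y => |v y| ^ γ * ‖y‖ ^ b) y‖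
      ≤ γ * (|v y| ^ (γ - 1) * ‖fderiv ℝ v y‖ * ‖y‖ ^ b) + |b| * (|v y| ^ γ * ‖y‖ ^ (b - 1)) := by
  by_cases hy : y = 0
  · subst hy
    rw [(wp_zero h (by linarith : 0 < γ) b).fderiv_eq]
    simp [h.v0, Real.zero_rpow (by linarith : γ ≠ 0), Real.zero_rpow (by linarith : γ - 1 ≠ 0)]
  have hpos : 0 < ‖y‖ := norm_pos_iff.2 hy
  rw [(wp_hasFDerivAt h hγ b hy).fderiv]
  have h1 := norm_fderiv_norm_rpow_le (h.cd.differentiable one_ne_zero) (x := y) hγ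
  refine (norm_add_le _ _).trans ?_
  rw [add_comm, norm_smul, norm_smul, norm_smul, innerSL_apply_norm]
  have e : ‖y‖ ^ (b - 1) = ‖y‖ ^ (b - 2) * ‖y‖ := by
    rw [← Real.rpow_add_one hpos.ne']; congr 1; ring
  rw [e]
  simp only [norm_mul, Real.norm_eq_abs] at h1 ⊢
  rw [abs_of_nonneg (Real.rpow_nonneg hpos.le b), abs_of_nonneg (Real.rpow_nonneg hpos.le _),
    abs_of_nonneg (Real.rpow_nonneg (abs_nonneg _) _)]
  refine add_le_add ?_ (le_of_eq (by ring))
  calc _ ≤ ‖y‖ ^ b * (γ * |v y| ^ (γ - 1) * ‖fderiv ℝ v y‖) := by gcongr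
    _ = _ := by ring

lemma euler_int {g : EuclideanSpace ℝ (Fin n) → ℝ} (hg : ContDiff ℝ 1 g)
    (hc : HasCompactSupport g) : ∫ y, fderiv ℝ g y y = - n * ∫ y, g y := by
  have key : ∀ i : Fin n, ∫ y : EuclideanSpace ℝ (Fin n),
      y i * fderiv ℝ g y (EuclideanSpace.single i 1) = - ∫ y, g y := by
    intro i
    let l : EuclideanSpace ℝ (Fin n) →L[ℝ] ℝ := EuclideanSpace.proj i
    have hl : ∀ y : EuclideanSpace ℝ (Fin n), l y = y i := fun y => rfl
    have := integral_mul_fderiv_eq_neg_fderiv_mul_of_integrable (μ := volume) (f := fun y => l y) (g := g)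
      (v := EuclideanSpace.single i (1:ℝ)) ?_ ?_ ?_ (fun x _ => l.differentiable x)
      (fun x _ => hg.differentiable one_ne_zero x)
    · simp only [hl] at this
      rw [this]
      congr 1
      refine integral_congr_ae (Eventually.of_forall fun y => ?_)
      show fderiv ℝ l y _ * _ = _
      rw [l.fderiv]; simp [hl]
    · refine Continuous.integrable_of_hasCompactSupport ?_ hc.mul_left
      refine Continuous.mul ?_ hg.continuous
      show Continuous fun y => fderiv ℝ l y _
      simp only [l.fderiv]; fun_prop
    · refine Continuous.integrable_of_hasCompactSupport ?_ ?_
      · have := hg.continuous_fderiv one_ne_zero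
        fun_prop
      · exact (hc.fderiv_apply ℝ _).mul_left
    · refine Continuous.integrable_of_hasCompactSupport ?_ hc.mul_left
      have := hg.continuous
      fun_prop
  have e : ∀ y : EuclideanSpace ℝ (Fin n), fderiv ℝ g y y =
      ∑ i, y i * fderiv ℝ g y (EuclideanSpace.single i 1) := by
    intro y
    have hs : ∑ i, y i • EuclideanSpace.single i (1:ℝ) = y := by
      have := (EuclideanSpace.basisFun (Fin n) ℝ).sum_repr y
      simpa using this
    calc fderiv ℝ g y y = fderiv ℝ g y (∑ i, y i • EuclideanSpace.single i (1:ℝ)) := by rw [hs]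
      _ = _ := by
        rw [map_sum]
        refine Finset.sum_congr rfl fun i _ => ?_
        rw [map_smul, smul_eq_mul]
  simp_rw [e]
  rw [integral_finsetSum]
  · simp [key]
  · intro i _
    refine Continuous.integrable_of_hasCompactSupport ?_ ?_
    · have := hg.continuous_fderiv one_ne_zero
      fun_prop
    · exact (hc.fderiv_apply ℝ _).mul_left
end aux

section ckn
variable {n : ℕ}

lemma real_holder {α : Type*} [MeasurableSpace α] {μ : Measure α} {f g h : α → ℝ}
    (hf : Integrable f μ) (hg : Integrable g μ) (hh : Integrable h μ)
    (f0 : ∀ x, 0 ≤ f x) (g0 : ∀ x, 0 ≤ g x) (h0 : ∀ x, 0 ≤ h x)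
    {a b : ℝ} (ha : 0 ≤ a) (hb : 0 ≤ b) (hab : a + b = 1)
    (hle : ∀ x, h x ≤ f x ^ a * g x ^ b) :
    ∫ x, h x ∂μ ≤ (∫ x, f x ∂μ) ^ a * (∫ x, g x ∂μ) ^ b := by
  have F0 : 0 ≤ ∫ x, f x ∂μ := integral_nonneg f0
  have G0 : 0 ≤ ∫ x, g x ∂μ := integral_nonneg g0
  have key := ENNReal.lintegral_mul_norm_pow_le (μ := μ) (f := fun x => ENNReal.ofReal (f x))
    (g := fun x => ENNReal.ofReal (g x)) hf.aestronglyMeasurable.aemeasurable.ennreal_ofReal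
    hg.aestronglyMeasurable.aemeasurable.ennreal_ofReal ha hb hab
  rw [← ofReal_integral_eq_lintegral_ofReal hf (Eventually.of_forall f0),
    ← ofReal_integral_eq_lintegral_ofReal hg (Eventually.of_forall g0),
    ENNReal.ofReal_rpow_of_nonneg F0 ha, ENNReal.ofReal_rpow_of_nonneg G0 hb,
    ← ENNReal.ofReal_mul (by positivity)] at key
  rw [← ENNReal.ofReal_le_ofReal_iff (by positivity),
    ofReal_integral_eq_lintegral_ofReal hh (Eventually.of_forall h0)]
  refine le_trans (lintegral_mono fun x => ?_) key
  show _ ≤ ENNReal.ofReal (f x) ^ a * ENNReal.ofReal (g x) ^ b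
  rw [ENNReal.ofReal_rpow_of_nonneg (f0 x) ha, ENNReal.ofReal_rpow_of_nonneg (g0 x) hb,
    ← ENNReal.ofReal_mul (Real.rpow_nonneg (f0 x) _)]
  exact ENNReal.ofReal_le_ofReal (hle x)

/-- the potential term -/
noncomputable def IQ (p Q : ℝ) (v : EuclideanSpace ℝ (Fin n) → ℝ) : ℝ :=
  ∫ y, |v y| ^ Q * ‖y‖ ^ (-((p - 1) / p * Q) - n)

/-- the gradient term -/
noncomputable def EN (p : ℝ) (v : EuclideanSpace ℝ (Fin n) → ℝ) : ℝ :=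
  ∫ y, ‖fderiv ℝ v y‖ ^ p * ‖y‖ ^ (1 - (n:ℝ))

lemma IQ_nonneg (p Q : ℝ) (v : EuclideanSpace ℝ (Fin n) → ℝ) : 0 ≤ IQ p Q v :=
  integral_nonneg fun y => by positivity

lemma EN_nonneg (p : ℝ) (v : EuclideanSpace ℝ (Fin n) → ℝ) : 0 ≤ EN p v :=
  integral_nonneg fun y => by positivity

lemma wp_int {v : EuclideanSpace ℝ (Fin n) → ℝ} (h : Good v) {γ : ℝ} (hγ : 0 < γ) (b : ℝ) :
    Integrable (fun y => |v y| ^ γ * ‖y‖ ^ b) :=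
  (wp_cont h hγ b).integrable_of_hasCompactSupport (wp_cs h hγ b)

lemma Good.dz {v : EuclideanSpace ℝ (Fin n) → ℝ} (h : Good v) : fderiv ℝ v =ᶠ[𝓝 0] 0 := by
  have := h.z.fderiv (𝕜 := ℝ)
  simpa using this

lemma dp_cont {v : EuclideanSpace ℝ (Fin n) → ℝ} (h : Good v) {a p : ℝ} (ha : 0 ≤ a) (hp : 0 < p)
    (b : ℝ) : Continuous (fun y => |v y| ^ a * ‖fderiv ℝ v y‖ ^ p * ‖y‖ ^ b) := by
  have hd := h.cd.continuous_fderiv one_ne_zero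
  rw [continuous_iff_continuousAt]
  intro y
  by_cases hy : y = 0
  · subst hy
    refine (continuousAt_const (y := (0:ℝ))).congr ?_
    filter_upwards [h.dz] with y hy
    simp [hy, Real.zero_rpow hp.ne']
  · have h1 : ContinuousAt v y := h.cd.continuous.continuousAt
    have h2 := hd.continuousAt (x := y)
    refine ((h1.abs.rpow_const (Or.inr ha)).mul (h2.norm.rpow_const (Or.inr hp.le))).mul ?_
    exact continuous_norm.continuousAt.rpow_const (Or.inl (by simpa using hy))

lemma dp_int {v : EuclideanSpace ℝ (Fin n) → ℝ} (h : Good v) {a p : ℝ} (ha : 0 ≤ a) (hp : 0 < p)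
    (b : ℝ) : Integrable (fun y => |v y| ^ a * ‖fderiv ℝ v y‖ ^ p * ‖y‖ ^ b) := by
  refine (dp_cont h ha hp b).integrable_of_hasCompactSupport ?_
  refine (h.cs.fderiv (𝕜 := ℝ)).mono ?_
  intro y hy
  contrapose! hy
  simp only [Function.mem_support, not_not] at hy ⊢
  simp [hy, Real.zero_rpow hp.ne']

lemma en_int {v : EuclideanSpace ℝ (Fin n) → ℝ} (h : Good v) {p : ℝ} (hp : 0 < p) :
    Integrable (fun y => ‖fderiv ℝ v y‖ ^ p * ‖y‖ ^ (1 - (n:ℝ))) := by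
  have := dp_int h le_rfl hp (1 - (n:ℝ))
  simpa using this

lemma d1_int {v : EuclideanSpace ℝ (Fin n) → ℝ} (h : Good v) {a : ℝ} (ha : 0 ≤ a)
    (b : ℝ) : Integrable (fun y => |v y| ^ a * ‖fderiv ℝ v y‖ * ‖y‖ ^ b) := by
  have := dp_int h ha one_pos b
  simpa using this

lemma holderA {v : EuclideanSpace ℝ (Fin n) → ℝ} (h : Good v) {p γ : ℝ} (hp : 1 < p)
    (hγ : 1 < γ) {b Q : ℝ} (hb : b = -((p - 1) / p * γ) - (n - 1))
    (hQ : (p - 1) / p * Q = γ - 1) :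
    ∫ y, |v y| ^ (γ - 1) * ‖fderiv ℝ v y‖ * ‖y‖ ^ b ≤
      EN p v ^ (1 / p) * IQ p Q v ^ ((p - 1) / p) := by
  have p0 : 0 < p := by linarith
  have hc : 0 < (p - 1) / p := div_pos (by linarith) p0
  have hQ0 : 0 < Q := by
    by_contra hh
    push Not at hh
    have := mul_nonpos_of_nonneg_of_nonpos hc.le hh
    linarith
  refine real_holder (en_int h p0) (wp_int h hQ0 _) (d1_int h (by linarith) b)
    (fun y => by positivity) (fun y => by positivity) (fun y => by positivity)
    (by positivity) hc.le (by field_simp; ring) ?_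
  intro y
  by_cases hy : y = 0
  · subst hy
    simp only [h.v0, abs_zero, Real.zero_rpow (by linarith : γ - 1 ≠ 0), zero_mul]
    positivity
  have hpos : 0 < ‖y‖ := norm_pos_iff.2 hy
  rw [Real.mul_rpow (by positivity) (by positivity), Real.mul_rpow (by positivity) (by positivity),
    ← Real.rpow_mul (norm_nonneg _), ← Real.rpow_mul (norm_nonneg _),
    ← Real.rpow_mul (norm_nonneg _), ← Real.rpow_mul (abs_nonneg _)]
  rw [mul_one_div_cancel p0.ne', Real.rpow_one, mul_comm Q, hQ]
  have : ‖y‖ ^ b = ‖y‖ ^ ((1 - (n:ℝ)) * (1 / p)) * ‖y‖ ^ ((-(γ - 1) - (n:ℝ)) * ((p - 1) / p)) := by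
    rw [← Real.rpow_add hpos, hb]; congr 1; field_simp; ring
  rw [this]
  apply le_of_eq
  ring

lemma holderB {v : EuclideanSpace ℝ (Fin n) → ℝ} (h : Good v) {p γ : ℝ} (hp : 1 < p)
    (hγ : 1 < γ) {b Q : ℝ} (hb : b = -((p - 1) / p * γ) - (n - 1))
    (hQ : (p - 1) / p * Q = γ - 1) :
    ∫ y, |v y| ^ γ * ‖y‖ ^ (b - 1) ≤
      IQ p p v ^ (1 / p) * IQ p Q v ^ ((p - 1) / p) := by
  have p0 : 0 < p := by linarith
  have hc : 0 < (p - 1) / p := div_pos (by linarith) p0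
  have hQ0 : 0 < Q := by
    by_contra hh
    push Not at hh
    have := mul_nonpos_of_nonneg_of_nonpos hc.le hh
    linarith
  refine real_holder (wp_int h p0 _) (wp_int h hQ0 _) (wp_int h (by linarith) _)
    (fun y => by positivity) (fun y => by positivity) (fun y => by positivity)
    (by positivity) hc.le (by field_simp; ring) ?_
  intro y
  by_cases hy : y = 0
  · subst hy
    simp only [h.v0, abs_zero, Real.zero_rpow (by linarith : γ ≠ 0), zero_mul]
    positivity
  have hpos : 0 < ‖y‖ := norm_pos_iff.2 hy
  rw [Real.mul_rpow (by positivity) (by positivity), Real.mul_rpow (by positivity) (by positivity),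
    ← Real.rpow_mul (norm_nonneg _), ← Real.rpow_mul (abs_nonneg _),
    ← Real.rpow_mul (norm_nonneg _), ← Real.rpow_mul (abs_nonneg _)]
  rw [mul_one_div_cancel p0.ne', Real.rpow_one, mul_comm Q, hQ]
  have : ‖y‖ ^ (b - 1) = ‖y‖ ^ ((-((p - 1) / p * p) - (n:ℝ)) * (1 / p)) *
      ‖y‖ ^ ((-(γ - 1) - (n:ℝ)) * ((p - 1) / p)) := by
    rw [← Real.rpow_add hpos, hb]; congr 1; field_simp; ring
  rw [this]
  have e : |v y| ^ γ = |v y| * |v y| ^ (γ - 1) := by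
    rw [mul_comm, ← Real.rpow_add_one' (abs_nonneg _) (by linarith)]; congr 1; ring
  rw [e]
  apply le_of_eq
  ring

/-- absorption -/
lemma absorb {I A θ : ℝ} (hI : 0 ≤ I) (hA : 0 ≤ A) (h1 : θ < 1)
    (h : I ≤ A * I ^ θ) : I ≤ A ^ (1 / (1 - θ)) := by
  rcases hI.eq_or_lt with h' | h'
  · rw [← h']; positivity
  have h2 : I ^ (1 - θ) ≤ A := by
    rw [Real.rpow_sub h', Real.rpow_one, div_le_iff₀ (by positivity)]; exact h
  calc I = (I ^ (1 - θ)) ^ (1 / (1 - θ)) := by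
        rw [← Real.rpow_mul hI, mul_one_div_cancel (by linarith), Real.rpow_one]
    _ ≤ _ := by
        apply Real.rpow_le_rpow (by positivity) h2
        have : 0 < 1 - θ := by linarith
        positivity

lemma hardy {v : EuclideanSpace ℝ (Fin n) → ℝ} (h : Good v) {p : ℝ} (hp : 1 < p) :
    IQ p p v ≤ (p / (p - 1)) ^ p * EN p v := by
  have p0 : 0 < p := by linarith
  have p1 : 0 < p - 1 := by linarith
  set b : ℝ := -((p - 1) / p * p) - n with hb
  have hcc : (p - 1) / p * p = p - 1 := by field_simp
  have hA := holderA h hp hp (b := b + 1) (Q := p) (by rw [hb]; ring) hcc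
  have he := euler_int (wp_cd h hp b) (wp_cs h p0 b)
  have hcd := wp_cd h hp b
  have i1 : Integrable fun y => fderiv ℝ (fun y => |v y| ^ p * ‖y‖ ^ b) y y := by
    refine Continuous.integrable_of_hasCompactSupport ?_ ?_
    · have := hcd.continuous_fderiv one_ne_zero
      fun_prop
    · refine ((wp_cs h p0 b).fderiv (𝕜 := ℝ)).mono ?_
      intro y hy
      contrapose! hy
      simp only [Function.mem_support, not_not] at hy ⊢
      simp [hy]
  have i2 := wp_int h p0 b
  have e1 : ∫ y, (fderiv ℝ (fun y => |v y| ^ p * ‖y‖ ^ b) y y - b * (|v y| ^ p * ‖y‖ ^ b))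
      = (p - 1) * IQ p p v := by
    rw [integral_sub i1 (i2.const_mul b), he, integral_const_mul]
    unfold IQ
    rw [← hb]
    have : p - 1 = - n - b := by rw [hb, hcc]; ring
    rw [this]; ring
  have e2 : (p - 1) * IQ p p v ≤ p * ∫ y, |v y| ^ (p - 1) * ‖fderiv ℝ v y‖ * ‖y‖ ^ (b + 1) := by
    rw [← e1, ← integral_const_mul]
    refine integral_mono (i1.sub (i2.const_mul b)) ((d1_int h p1.le _).const_mul p) ?_
    intro y
    exact (le_abs_self _).trans (wp_fderiv_apply h hp b y)
  have e3 : IQ p p v ≤ (p / (p - 1) * EN p v ^ (1 / p)) * IQ p p v ^ ((p - 1) / p) := by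
    have : (p - 1) * IQ p p v ≤ p * (EN p v ^ (1 / p) * IQ p p v ^ ((p - 1) / p)) :=
      e2.trans (by gcongr)
    calc IQ p p v = ((p - 1) * IQ p p v) / (p - 1) := by field_simp
      _ ≤ (p * (EN p v ^ (1 / p) * IQ p p v ^ ((p - 1) / p))) / (p - 1) := by gcongr
      _ = _ := by ring
  have E0 := EN_nonneg p v
  have e4 := absorb (IQ_nonneg _ _ _) (by positivity) (by rw [div_lt_one p0]; linarith) e3
  have : 1 / (1 - (p - 1) / p) = p := by field_simp; ring
  rw [this, Real.mul_rpow (by positivity) (by positivity), ← Real.rpow_mul E0,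
    one_div_mul_cancel p0.ne', Real.rpow_one] at e4
  exact e4

lemma grad_bound {p γ : ℝ} (hp : 1 < p)
    (hγ : 1 < γ) {b Q : ℝ} (hb : b = -((p - 1) / p * γ) - (n - 1))
    (hQ : (p - 1) / p * Q = γ - 1) :
    ∃ C : ℝ, 0 < C ∧ ∀ v : EuclideanSpace ℝ (Fin n) → ℝ, Good v →
      ∫ y, ‖fderiv ℝ (fun y => |v y| ^ γ * ‖y‖ ^ b) y‖ ≤
        C * (EN p v ^ (1 / p) * IQ p Q v ^ ((p - 1) / p)) := by
  have p0 : 0 < p := by linarith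
  have p1 : 0 < p - 1 := by linarith
  refine ⟨γ + |b| * (p / (p - 1)), by positivity, fun v h => ?_⟩
  have E0 := EN_nonneg p v
  have I0 := IQ_nonneg p p v
  have I1 := IQ_nonneg p Q v
  have h1 : ∫ y, ‖fderiv ℝ (fun y => |v y| ^ γ * ‖y‖ ^ b) y‖ ≤
      ∫ y, (γ * (|v y| ^ (γ - 1) * ‖fderiv ℝ v y‖ * ‖y‖ ^ b) + |b| * (|v y| ^ γ * ‖y‖ ^ (b - 1))) := by
    refine integral_mono_of_nonneg (Eventually.of_forall fun y => norm_nonneg _) ?_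
      (Eventually.of_forall fun y => wp_fderiv_norm h hγ b y)
    exact ((d1_int h (by linarith) b).const_mul γ).add ((wp_int h (by linarith) (b-1)).const_mul |b|)
  rw [integral_add ((d1_int h (by linarith) b).const_mul γ)
    ((wp_int h (by linarith) (b-1)).const_mul |b|), integral_const_mul, integral_const_mul] at h1
  have hA := holderA h hp hγ hb hQ
  have hB := holderB h hp hγ hb hQ
  have hH : IQ p p v ^ (1 / p) ≤ p / (p - 1) * EN p v ^ (1 / p) := by
    calc IQ p p v ^ (1 / p) ≤ ((p / (p - 1)) ^ p * EN p v) ^ (1 / p) :=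
          Real.rpow_le_rpow I0 (hardy h hp) (by positivity)
      _ = _ := by
        rw [Real.mul_rpow (by positivity) E0, ← Real.rpow_mul (by positivity),
          mul_one_div_cancel p0.ne', Real.rpow_one]
  calc _ ≤ _ := h1
    _ ≤ γ * (EN p v ^ (1 / p) * IQ p Q v ^ ((p - 1) / p)) +
        |b| * ((p / (p - 1) * EN p v ^ (1 / p)) * IQ p Q v ^ ((p - 1) / p)) := by
      gcongr
      exact hB.trans (by gcongr)
    _ = _ := by ring

lemma interp {v : EuclideanSpace ℝ (Fin n) → ℝ} (h : Good v) {p a b θ : ℝ} (ha : 0 < a) (hb : 0 < b)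
    (h0 : 0 ≤ θ) (h1 : θ ≤ 1) :
    IQ p ((1 - θ) * a + θ * b) v ≤ IQ p a v ^ (1 - θ) * IQ p b v ^ θ := by
  have hq : 0 < (1 - θ) * a + θ * b := by
    rcases h0.eq_or_lt with h' | h'
    · rw [← h']; simpa using ha
    · have : 0 ≤ 1 - θ := by linarith
      positivity
  refine real_holder (wp_int h ha _) (wp_int h hb _) (wp_int h hq _)
    (fun y => by positivity) (fun y => by positivity) (fun y => by positivity)
    (by linarith) h0 (by ring) ?_
  intro y
  by_cases hy : v y = 0
  · simp only [hy, abs_zero, Real.zero_rpow hq.ne', zero_mul]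
    positivity
  have hy' : y ≠ 0 := fun h' => hy (h' ▸ h.v0)
  have hpos : 0 < ‖y‖ := norm_pos_iff.2 hy'
  have hv : 0 < |v y| := abs_pos.2 hy
  rw [Real.mul_rpow (by positivity) (by positivity), Real.mul_rpow (by positivity) (by positivity),
    ← Real.rpow_mul (norm_nonneg _), ← Real.rpow_mul (abs_nonneg _),
    ← Real.rpow_mul (norm_nonneg _), ← Real.rpow_mul (abs_nonneg _)]
  have e1 : |v y| ^ ((1 - θ) * a + θ * b) = |v y| ^ (a * (1 - θ)) * |v y| ^ (b * θ) := by
    rw [← Real.rpow_add hv]; congr 1; ring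
  rw [e1]
  have e2 : ‖y‖ ^ (-((p - 1) / p * ((1 - θ) * a + θ * b)) - (n:ℝ)) =
      ‖y‖ ^ ((-((p - 1) / p * a) - (n:ℝ)) * (1 - θ)) * ‖y‖ ^ ((-((p - 1) / p * b) - (n:ℝ)) * θ) := by
    rw [← Real.rpow_add hpos]; congr 1; ring
  rw [e2]
  apply le_of_eq
  ring

end ckn

section ckn2
variable {n : ℕ}

lemma gns {p γ m : ℝ} (hn : 2 ≤ n) (hm : m = n / (n - 1)) (hp : 1 < p)
    (hγ : 1 < γ) {Q : ℝ} (hQ : (p - 1) / p * Q = γ - 1) :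
    ∃ C : ℝ, 0 < C ∧ ∀ v : EuclideanSpace ℝ (Fin n) → ℝ, Good v →
      IQ p (γ * m) v ≤ C * (EN p v ^ (1 / p) * IQ p Q v ^ ((p - 1) / p)) ^ m := by
  have hn' : (2:ℝ) ≤ n := by exact_mod_cast hn
  have hn1 : (0:ℝ) < n - 1 := by linarith
  have m0 : 0 < m := by rw [hm]; apply div_pos <;> linarith
  set b : ℝ := -((p - 1) / p * γ) - (n - 1) with hb
  obtain ⟨C, C0, hC⟩ := grad_bound (n := n) hp hγ hb hQ
  have hconj : Real.HolderConjugate (Module.finrank ℝ (EuclideanSpace ℝ (Fin n))) m := by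
    rw [finrank_euclideanSpace_fin, Real.holderConjugate_iff]
    refine ⟨by linarith, ?_⟩
    rw [hm]; field_simp; ring
  set K : NNReal := lintegralPowLePowLIntegralFDerivConst
    (volume : Measure (EuclideanSpace ℝ (Fin n))) m with hK
  refine ⟨((K:ℝ) + 1) * C ^ m, by positivity, fun v h => ?_⟩
  have E0 := EN_nonneg p v
  have I1 := IQ_nonneg p Q v
  have key := lintegral_pow_le_pow_lintegral_fderiv (volume) (wp_cd h hγ b)
    (wp_cs h (by linarith : 0 < γ) b) hconj
  have hcd := wp_cd h hγ b
  have i1 : Integrable fun y => ‖fderiv ℝ (fun y => |v y| ^ γ * ‖y‖ ^ b) y‖ := by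
    refine Integrable.norm (Continuous.integrable_of_hasCompactSupport ?_ ?_)
    · exact hcd.continuous_fderiv one_ne_zero
    · exact (wp_cs h (by linarith : 0 < γ) b).fderiv (𝕜 := ℝ)
  have e1 : ∫⁻ y, ‖fderiv ℝ (fun y => |v y| ^ γ * ‖y‖ ^ b) y‖ₑ =
      ENNReal.ofReal (∫ y, ‖fderiv ℝ (fun y => |v y| ^ γ * ‖y‖ ^ b) y‖) := by
    rw [ofReal_integral_eq_lintegral_ofReal i1 (Eventually.of_forall fun y => norm_nonneg _)]
    simp only [ofReal_norm]
  have hq0 : 0 < γ * m := by positivity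
  have e2 : ∫⁻ y, ‖(fun y => |v y| ^ γ * ‖y‖ ^ b) y‖ₑ ^ m = ENNReal.ofReal (IQ p (γ * m) v) := by
    unfold IQ
    rw [ofReal_integral_eq_lintegral_ofReal (wp_int h hq0 _)
      (Eventually.of_forall fun y => by positivity)]
    refine lintegral_congr fun y => ?_
    have g0 : 0 ≤ |v y| ^ γ * ‖y‖ ^ b := by positivity
    rw [Real.enorm_eq_ofReal g0, ENNReal.ofReal_rpow_of_nonneg g0 m0.le,
      Real.mul_rpow (by positivity) (by positivity), ← Real.rpow_mul (abs_nonneg _),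
      ← Real.rpow_mul (norm_nonneg _)]
    congr 3
    rw [hb, hm]; field_simp
  rw [e1, e2, ← hK, ENNReal.ofReal_rpow_of_nonneg (integral_nonneg fun y => norm_nonneg _) m0.le,
    ← ENNReal.ofReal_coe_nnreal, ← ENNReal.ofReal_mul (NNReal.coe_nonneg K)] at key
  have key2 := (ENNReal.ofReal_le_ofReal_iff (by positivity)).1 key
  calc _ ≤ _ := key2
    _ ≤ (K + 1) * (C * (EN p v ^ (1 / p) * IQ p Q v ^ ((p - 1) / p))) ^ m := by
        gcongr
        · linarith
        · exact hC v h
    _ = _ := by rw [Real.mul_rpow C0.le (by positivity)]; ring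

lemma sup1 {g : EuclideanSpace ℝ (Fin 1) → ℝ} (hg : ContDiff ℝ 1 g) (hc : HasCompactSupport g)
    (y : EuclideanSpace ℝ (Fin 1)) : |g y| ≤ ∫ z, ‖fderiv ℝ g z‖ := by
  let e : ℝ ≃ₗᵢ[ℝ] EuclideanSpace ℝ (Fin 1) :=
    (OrthonormalBasis.singleton (Fin 1) ℝ).repr
  obtain ⟨t, rfl⟩ := e.surjective y
  have i1 : Integrable fun y => ‖fderiv ℝ g y‖ :=
    ((hg.continuous_fderiv one_ne_zero).integrable_of_hasCompactSupport
      (hc.fderiv (𝕜 := ℝ))).norm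
  have h1 := HasCompactSupport.enorm_le_lintegral_Ici_deriv (f := g ∘ e)
    (hg.comp e.contDiff) (hc.comp_homeomorph e.toHomeomorph) t
  have h2 : ∫⁻ y in Iic t, ‖deriv (g ∘ e) y‖ₑ ≤ ENNReal.ofReal (∫ z, ‖fderiv ℝ g z‖) := by
    rw [ofReal_integral_eq_lintegral_ofReal i1 (Eventually.of_forall fun y => norm_nonneg _)]
    rw [← e.measurePreserving.lintegral_comp_emb e.toHomeomorph.measurableEmbedding]
    refine (setLIntegral_le_lintegral _ _).trans (lintegral_mono fun s => ?_)
    rw [← ofReal_norm]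
    apply ENNReal.ofReal_le_ofReal
    have hd : HasDerivAt (g ∘ e) (fderiv ℝ g (e s) (e 1)) s := by
      have a1 := (hg.differentiable one_ne_zero (e s)).hasFDerivAt
      have a2 : HasDerivAt e (e 1) s := by
        have := (e.toContinuousLinearEquiv : ℝ →L[ℝ] EuclideanSpace ℝ (Fin 1)).hasDerivAt (x := s)
        simpa using this
      exact a1.comp_hasDerivAt s a2
    rw [hd.deriv]
    calc _ ≤ ‖fderiv ℝ g (e s)‖ * ‖e 1‖ := ContinuousLinearMap.le_opNorm _ _
      _ = _ := by simp
  have h3 := h1.trans h2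
  rw [← ofReal_norm, ENNReal.ofReal_le_ofReal_iff
    (integral_nonneg fun y => norm_nonneg _)] at h3
  exact h3

lemma ckn1 {p q : ℝ} (hp : 1 < p) (hpq : p ≤ q) :
    ∃ C : ℝ, 0 < C ∧ ∀ v : EuclideanSpace ℝ (Fin 1) → ℝ, Good v →
      IQ p q v ≤ C * EN p v ^ (q / p) := by
  have p0 : 0 < p := by linarith
  have p1 : 0 < p - 1 := by linarith
  have hcc : (p - 1) / p * p = p - 1 := by field_simp
  obtain ⟨C, C0, hC⟩ := grad_bound (n := 1) hp hp
    (b := -(p - 1)) (Q := p) (by rw [hcc]; simp) hcc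
  set H := (p / (p - 1)) ^ p with hH
  have H0 : 0 < H := by positivity
  set D := C * H ^ ((p - 1) / p) with hD
  have D0 : 0 < D := by positivity
  refine ⟨D ^ ((q - p) / p) * H, by positivity, fun v h => ?_⟩
  have E0 := EN_nonneg p v
  have I0 := IQ_nonneg p p v
  have hh := hardy h hp
  have r0 : 0 ≤ (q - p) / p := div_nonneg (by linarith) p0.le
  have sup : ∀ y, |v y| ^ p * ‖y‖ ^ (-(p - 1)) ≤ D * EN p v := by
    intro y
    refine (le_abs_self _).trans ((sup1 (wp_cd h hp _) (wp_cs h p0 _) y).trans ((hC v h).trans ?_))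
    calc C * (EN p v ^ (1 / p) * IQ p p v ^ ((p - 1) / p))
        ≤ C * (EN p v ^ (1 / p) * (H * EN p v) ^ ((p - 1) / p)) := by gcongr
      _ = C * H ^ ((p - 1) / p) * (EN p v ^ (1 / p) * EN p v ^ ((p - 1) / p)) := by
        rw [Real.mul_rpow H0.le E0]; ring
      _ = D * EN p v := by
        rw [← Real.rpow_add_of_nonneg E0 (by positivity) (by positivity)]
        rw [show 1 / p + (p - 1) / p = 1 by field_simp; ring, Real.rpow_one]
  calc IQ p q v ≤ ∫ y, (D * EN p v) ^ ((q - p) / p) *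
        (|v y| ^ p * ‖y‖ ^ (-((p - 1) / p * p) - ((1:ℕ):ℝ))) := by
        unfold IQ
        refine integral_mono (wp_int h (by linarith) _) ((wp_int h p0 _).const_mul _) fun y => ?_
        show |v y| ^ q * ‖y‖ ^ (-((p - 1) / p * q) - ((1:ℕ):ℝ)) ≤ _
        by_cases hy : v y = 0
        · simp only [hy, abs_zero, Real.zero_rpow (by linarith : q ≠ 0), zero_mul]
          positivity
        have hy' : y ≠ 0 := fun h' => hy (h' ▸ h.v0)
        have hpos : 0 < ‖y‖ := norm_pos_iff.2 hy'
        have hv : 0 < |v y| := abs_pos.2 hy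
        calc _ = (|v y| ^ p * ‖y‖ ^ (-(p - 1))) ^ ((q - p) / p) *
              (|v y| ^ p * ‖y‖ ^ (-((p - 1) / p * p) - ((1:ℕ):ℝ))) := by
              rw [Real.mul_rpow (by positivity) (by positivity), ← Real.rpow_mul (abs_nonneg _),
                ← Real.rpow_mul (norm_nonneg _)]
              rw [mul_mul_mul_comm, ← Real.rpow_add hv, ← Real.rpow_add hpos]
              congr 2
              · field_simp; ring
              · field_simp; ring
          _ ≤ _ := mul_le_mul_of_nonneg_right (Real.rpow_le_rpow (by positivity) (sup y) r0)
              (by positivity)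
    _ = (D * EN p v) ^ ((q - p) / p) * IQ p p v := by rw [integral_const_mul]; rfl
    _ ≤ (D * EN p v) ^ ((q - p) / p) * (H * EN p v) := by gcongr
    _ = D ^ ((q - p) / p) * H * (EN p v ^ ((q - p) / p) * EN p v ^ (1:ℝ)) := by
      rw [Real.mul_rpow D0.le E0, Real.rpow_one]; ring
    _ = _ := by
      rw [← Real.rpow_add_of_nonneg E0 r0 zero_le_one]
      congr 2; field_simp; ring

lemma ckn {p q : ℝ} (hn : 1 ≤ n) (hp : 1 < p) (hpq : p ≤ q) (h2 : 1 / p - 1 / q ≤ 1 / (n:ℝ)) :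
    ∃ C : ℝ, 0 < C ∧ ∀ v : EuclideanSpace ℝ (Fin n) → ℝ, Good v →
      IQ p q v ≤ C * EN p v ^ (q / p) := by
  rcases hn.eq_or_lt with h' | hn2
  · subst h'
    exact ckn1 hp hpq
  have hn' : (2:ℝ) ≤ n := by exact_mod_cast hn2
  have hn1 : (0:ℝ) < n - 1 := by linarith
  have p0 : 0 < p := by linarith
  have p1 : 0 < p - 1 := by linarith
  have q0 : 0 < q := by linarith
  have hcc : (p - 1) / p * p = p - 1 := by field_simp
  obtain ⟨m, hm⟩ : ∃ m : ℝ, m = n / (n - 1) := ⟨_, rfl⟩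
  have m1 : 1 < m := by rw [hm, lt_div_iff₀ hn1]; linarith
  have m0 : 0 < m := by linarith
  set H := (p / (p - 1)) ^ p with hH
  have H0 : 0 < H := by positivity
  by_cases hq : q ≤ p * m
  · obtain ⟨K, K0, hK⟩ := gns hn2 hm hp hp hcc
    obtain ⟨θ, hθ⟩ : ∃ θ : ℝ, θ = (q - p) / (p * m - p) := ⟨_, rfl⟩
    have hd : 0 < p * m - p := by nlinarith
    have t0 : 0 ≤ θ := by rw [hθ]; exact div_nonneg (by linarith) hd.le
    have t1 : θ ≤ 1 := by rw [hθ, div_le_one hd]; linarith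
    have hqe : q = (1 - θ) * p + θ * (p * m) := by
      have : θ * (p * m - p) = q - p := by rw [hθ, div_mul_cancel₀ _ hd.ne']
      linarith
    refine ⟨H ^ (1 - θ) * (K * H ^ ((p - 1) / p * m)) ^ θ, by positivity, fun v h => ?_⟩
    have E0 := EN_nonneg p v
    have I0 := IQ_nonneg p p v
    have I1 := IQ_nonneg p (p * m) v
    have hh := hardy h hp
    have hb : IQ p (p * m) v ≤ K * H ^ ((p - 1) / p * m) * EN p v ^ m := by
      calc _ ≤ _ := hK v h
        _ ≤ K * (EN p v ^ (1 / p) * (H * EN p v) ^ ((p - 1) / p)) ^ m := by gcongr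
        _ = _ := by
          rw [Real.mul_rpow H0.le E0, mul_left_comm,
            ← Real.rpow_add_of_nonneg E0 (by positivity) (by positivity)]
          rw [show 1 / p + (p - 1) / p = 1 by field_simp; ring, Real.rpow_one,
            Real.mul_rpow (by positivity) E0, ← Real.rpow_mul H0.le]
          ring
    have t2 : 0 ≤ 1 - θ := by linarith
    calc IQ p q v = IQ p ((1 - θ) * p + θ * (p * m)) v := by rw [← hqe]
      _ ≤ IQ p p v ^ (1 - θ) * IQ p (p * m) v ^ θ := interp h p0 (by positivity) t0 t1
      _ ≤ (H * EN p v) ^ (1 - θ) * (K * H ^ ((p - 1) / p * m) * EN p v ^ m) ^ θ := by gcongr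
      _ = H ^ (1 - θ) * (K * H ^ ((p - 1) / p * m)) ^ θ * (EN p v ^ (1 - θ) * EN p v ^ (m * θ)) := by
        rw [Real.mul_rpow H0.le E0, Real.mul_rpow (by positivity) (by positivity),
          ← Real.rpow_mul E0]
        ring
      _ = _ := by
        rw [← Real.rpow_add_of_nonneg E0 t2 (by positivity)]
        congr 2
        rw [eq_div_iff p0.ne']
        linarith
  · push Not at hq
    obtain ⟨γ, hγ⟩ : ∃ γ : ℝ, γ = q / m := ⟨_, rfl⟩
    have hγp : p < γ := by rw [hγ, lt_div_iff₀ m0]; exact hq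
    have hγm : γ * m = q := by rw [hγ]; field_simp
    obtain ⟨c, hc⟩ : ∃ c : ℝ, c = (p - 1) / p := ⟨_, rfl⟩
    have c0 : 0 < c := by rw [hc]; positivity
    have hcp : c * p = p - 1 := by rw [hc, hcc]
    have hc1 : 1 / p = 1 - c := by rw [hc]; field_simp; ring
    obtain ⟨Q, hQ⟩ : ∃ Q : ℝ, Q = (γ - 1) / c := ⟨_, rfl⟩
    have hQc : c * Q = γ - 1 := by rw [hQ]; field_simp
    obtain ⟨K, K0, hK⟩ := gns (Q := Q) hn2 hm hp (by linarith : 1 < γ) (by rw [← hc]; exact hQc)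
    have hqp : 0 < q - p := by nlinarith
    have hQp : p ≤ Q := by
      rw [hQ, le_div_iff₀ c0]; linarith
    have hQq : Q ≤ q := by
      rw [hQ, div_le_iff₀ c0]
      -- q/m - 1 ≤ q c
      have a1 : γ = q * (1 - 1 / n) := by rw [hγ, hm]; field_simp
      have a2 : q * (1 / p - 1 / q) ≤ q * (1 / n) := by gcongr
      have a3 : q * (1 / p - 1 / q) = q * (1 / p) - 1 := by field_simp
      rw [hc1] at a3
      rw [hc1] at a2
      nlinarith
    obtain ⟨θ, hθ⟩ : ∃ θ : ℝ, θ = (Q - p) / (q - p) := ⟨_, rfl⟩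
    have t0 : 0 ≤ θ := by rw [hθ]; exact div_nonneg (by linarith) hqp.le
    have t1 : θ ≤ 1 := by rw [hθ, div_le_one hqp]; linarith
    have t2 : 0 ≤ 1 - θ := by linarith
    have hθe : θ * (q - p) = Q - p := by rw [hθ]; field_simp
    have hQe : Q = (1 - θ) * p + θ * q := by linarith
    have t3 : θ * c * m < 1 := by
      -- θ c (q-p) = c Q - c p = γ - p
      have b1 : θ * c * (q - p) = γ - p := by
        calc _ = c * (θ * (q - p)) := by ring
          _ = c * Q - c * p := by rw [hθe]; ring
          _ = _ := by rw [hQc, hcp]; ring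
      have b2 : θ * c * m * (q - p) = q - p * m := by
        calc _ = (θ * c * (q - p)) * m := by ring
          _ = _ := by rw [b1, ← hγm]; ring
      have b3 : q - p * m < q - p := by nlinarith
      rw [← b2] at b3
      by_contra hcon
      push Not at hcon
      nlinarith
    have t4 : 0 < 1 - θ * c * m := by linarith
    refine ⟨(K * H ^ ((1 - θ) * c * m)) ^ (1 / (1 - θ * c * m)), by positivity, fun v h => ?_⟩
    have E0 := EN_nonneg p v
    have I0 := IQ_nonneg p p v
    have I1 := IQ_nonneg p q v
    have I2 := IQ_nonneg p Q v
    have hh := hardy h hp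
    have hi : IQ p Q v ≤ (H * EN p v) ^ (1 - θ) * IQ p q v ^ θ := by
      calc IQ p Q v = IQ p ((1 - θ) * p + θ * q) v := by rw [← hQe]
        _ ≤ IQ p p v ^ (1 - θ) * IQ p q v ^ θ := interp h p0 q0 t0 t1
        _ ≤ _ := by gcongr
    have hmain : IQ p q v ≤ (K * H ^ ((1 - θ) * c * m) *
        EN p v ^ (1 / p * m + (1 - θ) * c * m)) * IQ p q v ^ (θ * c * m) := by
      have := hK v h
      rw [hγm, ← hc] at this
      calc _ ≤ _ := this
        _ ≤ K * (EN p v ^ (1 / p) * ((H * EN p v) ^ (1 - θ) * IQ p q v ^ θ) ^ c) ^ m := by gcongr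
        _ = _ := by
          rw [Real.mul_rpow H0.le E0, Real.mul_rpow (by positivity) (by positivity),
            Real.mul_rpow (by positivity) (by positivity),
            Real.mul_rpow (by positivity) (by positivity),
            Real.mul_rpow (by positivity) (by positivity),
            Real.mul_rpow (by positivity) (by positivity),
            ← Real.rpow_mul H0.le, ← Real.rpow_mul H0.le, ← Real.rpow_mul E0, ← Real.rpow_mul E0,
            ← Real.rpow_mul E0, ← Real.rpow_mul I1, ← Real.rpow_mul I1,
            Real.rpow_add_of_nonneg E0 (by positivity) (by positivity)]
          ring
    have := absorb I1 (by positivity) t3 hmain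
    refine this.trans (le_of_eq ?_)
    rw [Real.mul_rpow (by positivity) (by positivity), ← Real.rpow_mul E0]
    congr 2
    -- exponent
    rw [mul_one_div, div_eq_div_iff t4.ne' p0.ne']
    have e1 : (1 / p * m + (1 - θ) * c * m) * p = m * (1 + c * ((1 - θ) * p)) := by
      field_simp
    have e2 : (1 - θ) * p = Q - θ * q := by linarith
    rw [e1, e2]
    calc m * (1 + c * (Q - θ * q)) = m * (1 + c * Q - c * θ * q) := by ring
      _ = γ * m - m * c * θ * q := by rw [hQc]; ring
      _ = _ := by rw [hγm]; ring

end ckn2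

section cov
variable {n : ℕ}

lemma polar (hn : 1 ≤ n) {F : EuclideanSpace ℝ (Fin n) → ENNReal} (hF : Measurable F) :
    ∫⁻ x, F x = ∫⁻ ω, (∫⁻ r in Ioi (0:ℝ), ENNReal.ofReal (r ^ (n - 1)) * F (r • ω.1))
      ∂(volume : Measure (EuclideanSpace ℝ (Fin n))).toSphere := by
  have : Nonempty (Fin n) := ⟨⟨0, hn⟩⟩
  have : Nontrivial (EuclideanSpace ℝ (Fin n)) := inferInstance
  set μ : Measure (EuclideanSpace ℝ (Fin n)) := volume with hμ
  have h1 : ∫⁻ x, F x ∂μ = ∫⁻ x : ({(0)}ᶜ : Set (EuclideanSpace ℝ (Fin n))), F x.1 ∂(μ.comap (↑)) := by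
    rw [lintegral_subtype_comap (measurableSet_singleton _).compl F, restrict_compl_singleton]
  have hmeas : Measurable fun z : Metric.sphere (0 : EuclideanSpace ℝ (Fin n)) 1 × Ioi (0:ℝ) =>
      F (z.2.1 • z.1.1) := by
    apply hF.comp
    fun_prop
  have h2 := μ.measurePreserving_homeomorphUnitSphereProd.lintegral_comp hmeas
  have h3 : ∀ x : ({(0)}ᶜ : Set (EuclideanSpace ℝ (Fin n))),
      ((homeomorphUnitSphereProd _ x).2.1 • (homeomorphUnitSphereProd _ x).1.1) = x.1 := by
    intro x
    have : ‖x.1‖ ≠ 0 := norm_ne_zero_iff.2 x.2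
    simp [smul_smul, this]
  simp only [h3] at h2
  rw [h1, h2, lintegral_prod _ hmeas.aemeasurable]
  refine lintegral_congr fun ω => ?_
  rw [finrank_euclideanSpace_fin, Measure.volumeIoiPow, lintegral_withDensity_eq_lintegral_mul]
  · rw [← lintegral_subtype_comap measurableSet_Ioi
      (fun r : ℝ => ENNReal.ofReal (r ^ (n - 1)) * F (r • ω.1))]
    rfl
  · fun_prop
  · exact hmeas.comp (by fun_prop : Measurable fun r : Ioi (0:ℝ) => (ω, r))

lemma rad_cancel {r : ℝ} (hr : 0 < r) (hn : 1 ≤ n) : r ^ (n - 1) * r ^ (1 - (n:ℝ)) = 1 := by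
  rw [← Real.rpow_natCast, ← Real.rpow_add hr, Nat.cast_sub hn]
  simp

lemma polar_w (hn : 1 ≤ n) {F : EuclideanSpace ℝ (Fin n) → ENNReal} (hF : Measurable F)
    {s : Set ℝ} (hs : MeasurableSet s) (hs0 : s ⊆ Ioi 0)
    {A : Set (EuclideanSpace ℝ (Fin n))} (hA : ∀ x, x ≠ 0 → (x ∈ A ↔ ‖x‖ ∈ s)) (hAm : MeasurableSet A) :
    ∫⁻ x in A, F x * ENNReal.ofReal (‖x‖ ^ (1 - (n:ℝ))) =
      ∫⁻ ω, (∫⁻ r in s, F (r • ω.1)) ∂(volume : Measure (EuclideanSpace ℝ (Fin n))).toSphere := by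
  rw [← lintegral_indicator hAm, polar hn]
  · refine lintegral_congr fun ω => ?_
    have hω : ‖ω.1‖ = 1 := by simp
    have hω0 : ω.1 ≠ 0 := by
      intro h; rw [h] at hω; simp at hω
    rw [← inter_eq_self_of_subset_left hs0, ← Measure.restrict_restrict hs, ← lintegral_indicator hs]
    refine setLIntegral_congr_fun measurableSet_Ioi fun r hr => ?_
    have hr : 0 < r := hr
    have hn1 : ‖r • ω.1‖ = r := by rw [norm_smul, hω, mul_one, Real.norm_of_nonneg hr.le]
    have hmem : r • ω.1 ∈ A ↔ r ∈ s := by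
      rw [hA _ (smul_ne_zero hr.ne' hω0), hn1]
    by_cases h : r ∈ s
    · simp only [indicator_of_mem (hmem.2 h), indicator_of_mem h, hn1]
      rw [mul_left_comm, ← ENNReal.ofReal_mul (by positivity), rad_cancel hr hn]
      simp
    · simp only [indicator_of_notMem (fun h' => h (hmem.1 h')), indicator_of_notMem h, mul_zero]
  · refine Measurable.indicator ?_ hAm
    fun_prop

lemma cov (hn : 1 ≤ n) {F : EuclideanSpace ℝ (Fin n) → ENNReal} (hF : Measurable F)
    {φ φ' : ℝ → ℝ} {s0 η : ℝ} (h0 : 0 ≤ s0) (hφ : Measurable φ) (hφ' : Measurable φ')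
    (hd : ∀ s ∈ Ioi s0, HasDerivAt φ (φ' s) s) (hinj : InjOn φ (Ioi s0))
    (him : φ '' (Ioi s0) = Ioo 0 η) :
    ∫⁻ x in Metric.ball 0 η, F x * ENNReal.ofReal (‖x‖ ^ (1 - (n:ℝ))) =
    ∫⁻ y in {y : EuclideanSpace ℝ (Fin n) | s0 < ‖y‖},
      (ENNReal.ofReal |φ' ‖y‖| * F ((φ ‖y‖ * ‖y‖⁻¹) • y)) * ENNReal.ofReal (‖y‖ ^ (1 - (n:ℝ))) := by
  rw [polar_w hn hF (s := Ioo 0 η) measurableSet_Ioo (fun x hx => hx.1) (fun x hx => by simp [hx])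
    Metric.isOpen_ball.measurableSet]
  rw [polar_w hn (s := Ioi s0) (F := fun y => ENNReal.ofReal |φ' ‖y‖| * F ((φ ‖y‖ * ‖y‖⁻¹) • y)) _
    measurableSet_Ioi (fun x hx => lt_of_le_of_lt h0 hx) (fun x hx => by simp)
    (measurableSet_lt measurable_const measurable_norm)]
  · refine lintegral_congr fun ω => ?_
    have hω : ‖ω.1‖ = 1 := by simp
    rw [← him, lintegral_image_eq_lintegral_abs_deriv_mul measurableSet_Ioi
      (fun x hx => (hd x hx).hasDerivWithinAt) hinj]
    refine setLIntegral_congr_fun measurableSet_Ioi fun r hr => ?_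
    have hr : 0 < r := lt_of_le_of_lt h0 hr
    have hn1 : ‖r • ω.1‖ = r := by rw [norm_smul, hω, mul_one, Real.norm_of_nonneg hr.le]
    simp only [hn1, smul_smul]
    rw [inv_mul_cancel_right₀ hr.ne']
  · refine Measurable.mul (by fun_prop) (hF.comp (by fun_prop))
end cov

section phi

/-- product of iterated exponentials -/
noncomputable def Pe (m : ℕ) (s : ℝ) : ℝ := ∏ i ∈ Finset.range m, Real.exp^[i + 1] s

lemma ex_hasDerivAt (m : ℕ) (s : ℝ) : HasDerivAt (Real.exp^[m]) (Pe m s) s := by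
  induction m with
  | zero => simpa [Pe] using hasDerivAt_id s
  | succ m ih =>
    have e : Real.exp^[m + 1] = fun s => Real.exp (Real.exp^[m] s) := by
      funext s; rw [Function.iterate_succ_apply']
    have := ih.exp
    rw [e]
    convert! this using 1
    unfold Pe
    rw [Finset.prod_range_succ, Function.iterate_succ_apply']
    ring

lemma ex_contDiff (m : ℕ) : ContDiff ℝ 1 (Real.exp^[m]) := by
  induction m with
  | zero => exact contDiff_id
  | succ m ih =>
    have e : Real.exp^[m + 1] = fun s => Real.exp (Real.exp^[m] s) := by
      funext s; rw [Function.iterate_succ_apply']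
    rw [e]; exact ih.exp

lemma ex_strictMono (m : ℕ) : StrictMono (Real.exp^[m]) := Real.exp_strictMono.iterate m

lemma ex_ge (m : ℕ) (s : ℝ) : s ≤ Real.exp^[m] s := by
  induction m with
  | zero => simp
  | succ m ih =>
    rw [Function.iterate_succ_apply']
    have := Real.add_one_le_exp (Real.exp^[m] s)
    linarith

lemma ex_pos (m : ℕ) (s : ℝ) : 0 < Real.exp^[m + 1] s := by
  rw [Function.iterate_succ_apply']; positivity

lemma Pe_one_le (m : ℕ) {s : ℝ} (hs : 1 ≤ s) : 1 ≤ Pe m s := by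
  unfold Pe
  refine Finset.one_le_prod fun i _ => hs.trans (ex_ge _ _)

lemma Pe_cont (m : ℕ) : Continuous (Pe m) := by
  unfold Pe
  exact continuous_finsetProd _ fun i _ => (ex_contDiff (i + 1)).continuous

lemma Pe_pos (m : ℕ) (s : ℝ) : 0 < Pe m s := Finset.prod_pos fun i _ => ex_pos i s

lemma ex_surj (m : ℕ) {T : ℝ} (hT : Real.exp^[m] 1 < T) : ∃ s, 1 < s ∧ Real.exp^[m] s = T := by
  have h1 : (1:ℝ) ≤ T := (ex_ge m 1).trans hT.le
  have := intermediate_value_Icc h1 (ex_contDiff m).continuous.continuousOn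
  obtain ⟨s, hs, he⟩ := this ⟨hT.le, ex_ge m T⟩
  refine ⟨s, lt_of_le_of_ne hs.1 ?_, he⟩
  rintro rfl
  exact hT.ne he

lemma log_ex {j m : ℕ} (hj : j ≤ m) (s : ℝ) : Real.log^[j] (Real.exp^[m] s) = Real.exp^[m - j] s := by
  conv_lhs => rw [show m = j + (m - j) by omega, Function.iterate_add_apply]
  exact Function.LeftInverse.iterate Real.log_exp j _

/-- radial change of variable -/
noncomputable def phi (k : ℕ) (R η s : ℝ) : ℝ := R * η / Real.exp^[k + 1] s

variable {k : ℕ} {R η : ℝ}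

lemma phi_pos (hR : 0 < R) (hη : 0 < η) (s : ℝ) : 0 < phi k R η s :=
  div_pos (by positivity) (ex_pos k s)

lemma phi_contDiff : ContDiff ℝ 1 (phi k R η) :=
  contDiff_const.div (ex_contDiff _) fun s => (ex_pos k s).ne'

lemma phi_hasDerivAt (s : ℝ) : HasDerivAt (phi k R η) (-(phi k R η s * Pe k s)) s := by
  have h0 := (ex_pos k s).ne'
  have := (hasDerivAt_const s (R * η)).div (ex_hasDerivAt (k + 1) s) h0
  convert! this using 1
  unfold phi
  have : Pe (k + 1) s = Pe k s * Real.exp^[k + 1] s := by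
    unfold Pe; rw [Finset.prod_range_succ]
  rw [this]
  field_simp
  ring

lemma phi_anti (hR : 0 < R) (hη : 0 < η) : StrictAnti (phi k R η) := by
  intro a b hab
  exact div_lt_div_of_pos_left (by positivity) (ex_pos k a) (ex_strictMono _ hab)

lemma phi_inv (hR : 0 < R) (hη : 0 < η) (s : ℝ) : R * η / phi k R η s = Real.exp^[k + 1] s := by
  unfold phi
  have h0 := (ex_pos k s).ne'
  field_simp

lemma wlog_phi (hk : 1 ≤ k) (hR : 0 < R) (hη : 0 < η) (s : ℝ) :
    wlog k 1 R η (phi k R η s) = phi k R η s * Pe k s := by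
  unfold wlog
  rw [phi_inv hR hη, Real.rpow_one, mul_assoc]
  congr 1
  rw [← Finset.prod_Ico_succ_top hk (fun j => Real.log^[j] (Real.exp^[k + 1] s))]
  rw [Finset.prod_Ico_eq_prod_range]
  unfold Pe
  rw [← Finset.prod_range_reflect]
  simp only [Nat.add_sub_cancel]
  refine Finset.prod_congr rfl fun i hi => ?_
  rw [Finset.mem_range] at hi
  rw [log_ex (by omega)]
  congr 2
  omega

lemma phi_image {s0 : ℝ} (hR : 0 < R) (hη : 0 < η) (h1 : 1 < s0) (hs0 : Real.exp^[k + 1] s0 = R) :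
    phi k R η '' (Ioi s0) = Ioo 0 η := by
  have e0 : phi k R η s0 = η := by
    unfold phi; rw [hs0]; field_simp
  ext t
  constructor
  · rintro ⟨s, hs, rfl⟩
    refine ⟨phi_pos hR hη s, ?_⟩
    calc _ < phi k R η s0 := phi_anti hR hη hs
      _ = η := e0
  · rintro ⟨ht, htη⟩
    have hlt : R < R * η / t := by
      rw [lt_div_iff₀ ht]; gcongr
    obtain ⟨s, _, hs⟩ := ex_surj (k + 1) (T := R * η / t)
      (((ex_strictMono (k+1)) h1).trans (hs0 ▸ hlt))
    refine ⟨s, ?_, ?_⟩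
    · rw [mem_Ioi, ← (ex_strictMono (k + 1)).lt_iff_lt, hs, hs0]; exact hlt
    · unfold phi; rw [hs]; field_simp

lemma phi_le {s : ℝ} (hR : 0 < R) (hη : 0 < η) (hs : 0 < s) : phi k R η s ≤ R * η / s :=
  div_le_div_of_nonneg_left (by positivity) hs (ex_ge _ _)

end phi

section psi
variable {n k : ℕ} {R η : ℝ}

/-- radial diffeomorphism -/
noncomputable def Psi (n k : ℕ) (R η : ℝ) (y : EuclideanSpace ℝ (Fin n)) : EuclideanSpace ℝ (Fin n) :=
  (phi k R η ‖y‖ * ‖y‖⁻¹) • y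

lemma Psi_norm (hR : 0 < R) (hη : 0 < η) {y : EuclideanSpace ℝ (Fin n)} (hy : y ≠ 0) :
    ‖Psi n k R η y‖ = phi k R η ‖y‖ := by
  have hpos : 0 < ‖y‖ := norm_pos_iff.2 hy
  have := phi_pos (k := k) hR hη ‖y‖
  unfold Psi
  rw [norm_smul, Real.norm_of_nonneg (by positivity)]
  field_simp

lemma Psi_cd {y : EuclideanSpace ℝ (Fin n)} (hy : y ≠ 0) : ContDiffAt ℝ 1 (Psi n k R η) y := by
  have h1 : ContDiffAt ℝ 1 (fun y : EuclideanSpace ℝ (Fin n) => ‖y‖) y := contDiffAt_norm ℝ hy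
  have hpos : ‖y‖ ≠ 0 := norm_ne_zero_iff.2 hy
  exact (((phi_contDiff (k := k) (R := R) (η := η)).contDiffAt.comp y h1).mul (h1.inv hpos)).smul
    contDiffAt_id

lemma Psi_fderiv (hR : 0 < R) (hη : 0 < η) {y : EuclideanSpace ℝ (Fin n)} (hy : 1 ≤ ‖y‖) :
    ‖fderiv ℝ (Psi n k R η) y‖ ≤ 3 * (phi k R η ‖y‖ * Pe k ‖y‖) := by
  have hpos : 0 < ‖y‖ := by linarith
  have hy0 : y ≠ 0 := norm_pos_iff.1 hpos
  have f0 := phi_pos (k := k) hR hη ‖y‖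
  have P1 := Pe_one_le k hy
  set L := fderiv ℝ (fun y : EuclideanSpace ℝ (Fin n) => ‖y‖) y with hL
  have hLd : HasFDerivAt (fun y : EuclideanSpace ℝ (Fin n) => ‖y‖) L y :=
    ((contDiffAt_norm (n := 1) ℝ hy0).differentiableAt one_ne_zero).hasFDerivAt
  have hL1 : ‖L‖ ≤ 1 := by
    have := norm_fderiv_le_of_lipschitz ℝ (x₀ := y)
      (lipschitzWith_one_norm (E := EuclideanSpace ℝ (Fin n)))
    simpa using this
  have hψ : HasDerivAt (fun s => phi k R η s * s⁻¹)
      (-(phi k R η ‖y‖ * Pe k ‖y‖) * ‖y‖⁻¹ + phi k R η ‖y‖ * (-(‖y‖ ^ 2)⁻¹)) ‖y‖ :=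
    (phi_hasDerivAt ‖y‖).mul (hasDerivAt_inv hpos.ne')
  have h1 := (hψ.comp_hasFDerivAt y hLd).smul (hasFDerivAt_id y)
  have h2 : HasFDerivAt (Psi n k R η) _ y := h1
  rw [h2.fderiv]
  refine (norm_add_le _ _).trans ?_
  rw [norm_smul, ContinuousLinearMap.norm_smulRight_apply, norm_smul]
  have a1 : ‖((fun s => phi k R η s * s⁻¹) ∘ fun y : EuclideanSpace ℝ (Fin n) => ‖y‖) y‖ ≤
      phi k R η ‖y‖ * Pe k ‖y‖ := by
    show ‖phi k R η ‖y‖ * ‖y‖⁻¹‖ ≤ _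
    rw [Real.norm_of_nonneg (by positivity)]
    gcongr
    exact (inv_le_one_of_one_le₀ hy).trans P1
  have a2 : ‖ContinuousLinearMap.id ℝ (EuclideanSpace ℝ (Fin n))‖ ≤ 1 :=
    ContinuousLinearMap.norm_id_le
  have a3 : ‖-(phi k R η ‖y‖ * Pe k ‖y‖) * ‖y‖⁻¹ + phi k R η ‖y‖ * (-(‖y‖ ^ 2)⁻¹)‖ * ‖y‖ ≤
      2 * (phi k R η ‖y‖ * Pe k ‖y‖) := by
    have e : -(phi k R η ‖y‖ * Pe k ‖y‖) * ‖y‖⁻¹ + phi k R η ‖y‖ * (-(‖y‖ ^ 2)⁻¹)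
      = - (phi k R η ‖y‖ * (Pe k ‖y‖ + ‖y‖⁻¹) * ‖y‖⁻¹) := by field_simp; ring
    have P0 := Pe_pos k ‖y‖
    rw [e, norm_neg, Real.norm_of_nonneg (by positivity), inv_mul_cancel_right₀ hpos.ne']
    have : ‖y‖⁻¹ ≤ Pe k ‖y‖ := (inv_le_one_of_one_le₀ hy).trans P1
    nlinarith
  have P0 := Pe_pos k ‖y‖
  calc _ ≤ (phi k R η ‖y‖ * Pe k ‖y‖) * 1 +
      (‖-(phi k R η ‖y‖ * Pe k ‖y‖) * ‖y‖⁻¹ + phi k R η ‖y‖ * (-(‖y‖ ^ 2)⁻¹)‖ * 1) * ‖y‖ := by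
        gcongr
        exact le_of_eq rfl
    _ ≤ _ := by rw [mul_one, mul_one]; linarith

end psi

section main
variable {n k : ℕ} {R η s0 : ℝ}

lemma comp_zero {X : Type*} [NormedAddCommGroup X] {f : EuclideanSpace ℝ (Fin n) → X}
    (hR : 0 < R) (hη : 0 < η) (hs0 : Real.exp^[k + 1] s0 = R)
    (hf : tsupport f ⊆ Metric.ball 0 η \ {0}) {y : EuclideanSpace ℝ (Fin n)} (hy : ‖y‖ ≤ s0) :
    f (Psi n k R η y) = 0 := by
  by_contra h
  have hm := hf (subset_tsupport f h)
  by_cases hy0 : y = 0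
  · apply hm.2
    simp [hy0, Psi]
  · have e0 : phi k R η s0 = η := by
      unfold phi; rw [hs0]; field_simp
    have h1 := hm.1
    rw [mem_ball_zero_iff, Psi_norm hR hη hy0] at h1
    have := (phi_anti (k := k) hR hη).antitone hy
    linarith

lemma comp_cs {X : Type*} [NormedAddCommGroup X] {f : EuclideanSpace ℝ (Fin n) → X}
    (hR : 0 < R) (hη : 0 < η)
    (hf : tsupport f ⊆ Metric.ball 0 η \ {0}) :
    HasCompactSupport (fun y => f (Psi n k R η y)) := by
  have h0 : (0 : EuclideanSpace ℝ (Fin n)) ∉ tsupport f := fun h => (hf h).2 rfl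
  have hz := notMem_tsupport_iff_eventuallyEq.1 h0
  obtain ⟨a, ha, hza⟩ := Metric.eventually_nhds_iff_ball.1 hz
  refine HasCompactSupport.intro (isCompact_closedBall (0 : EuclideanSpace ℝ (Fin n)) (R * η / a))
    fun y hy => hza _ ?_
  rw [mem_closedBall_zero_iff, not_le] at hy
  have hpos : 0 < ‖y‖ := lt_trans (by positivity) hy
  rw [mem_ball_zero_iff, Psi_norm hR hη (norm_pos_iff.1 hpos)]
  refine (phi_le hR hη hpos).trans_lt ?_
  rw [div_lt_iff₀ hpos]
  rw [div_lt_iff₀ ha] at hy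
  linarith

lemma comp_near {X : Type*} [NormedAddCommGroup X] {f : EuclideanSpace ℝ (Fin n) → X}
    (hR : 0 < R) (hη : 0 < η) (h1 : 1 < s0) (hs0 : Real.exp^[k + 1] s0 = R)
    (hf : tsupport f ⊆ Metric.ball 0 η \ {0}) :
    (fun y => f (Psi n k R η y)) =ᶠ[𝓝 0] 0 := by
  filter_upwards [Metric.ball_mem_nhds (0 : EuclideanSpace ℝ (Fin n)) (by linarith : 0 < s0)]
    with y hy
  rw [mem_ball_zero_iff] at hy
  exact comp_zero hR hη hs0 hf hy.le

lemma good_comp {u : EuclideanSpace ℝ (Fin n) → ℝ} (hu : ContDiff ℝ (⊤ : ℕ∞) u)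
    (hR : 0 < R) (hη : 0 < η) (h1 : 1 < s0) (hs0 : Real.exp^[k + 1] s0 = R)
    (hf : tsupport u ⊆ Metric.ball 0 η \ {0}) : Good (fun y => u (Psi n k R η y)) := by
  have hz := comp_near hR hη h1 hs0 hf
  refine ⟨?_, comp_cs hR hη hf, hz⟩
  rw [contDiff_iff_contDiffAt]
  intro y
  by_cases hy : y = 0
  · subst hy
    exact (contDiffAt_const (c := (0:ℝ))).congr_of_eventuallyEq hz
  · have hu1 : ContDiff ℝ 1 u := hu.of_le (by exact_mod_cast le_top)
    exact hu1.contDiffAt.comp y (Psi_cd hy)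

lemma covR (hn : 1 ≤ n) (hR : 0 < R) (hη : 0 < η) (h1 : 1 < s0) (hs0 : Real.exp^[k + 1] s0 = R)
    {f : EuclideanSpace ℝ (Fin n) → ℝ} (hf : Measurable f)
    (f0 : ∀ x ∈ Metric.ball (0 : EuclideanSpace ℝ (Fin n)) η, 0 ≤ f x) :
    ∫ x in Metric.ball (0 : EuclideanSpace ℝ (Fin n)) η, f x * ‖x‖ ^ (1 - (n:ℝ)) =
    ∫ y in {y : EuclideanSpace ℝ (Fin n) | s0 < ‖y‖},
      (phi k R η ‖y‖ * Pe k ‖y‖) * f (Psi n k R η y) * ‖y‖ ^ (1 - (n:ℝ)) := by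
  have hS : MeasurableSet {y : EuclideanSpace ℝ (Fin n) | s0 < ‖y‖} :=
    measurableSet_lt measurable_const measurable_norm
  have hphi : Measurable (phi k R η) := phi_contDiff.continuous.measurable
  have hPe : Measurable (Pe k) := (Pe_cont k).measurable
  have hPsi : Measurable (Psi n k R η) := by unfold Psi; fun_prop
  have e0 : phi k R η s0 = η := by
    unfold phi; rw [hs0]; field_simp
  have hmem : ∀ y : EuclideanSpace ℝ (Fin n), s0 < ‖y‖ →
      Psi n k R η y ∈ Metric.ball (0 : EuclideanSpace ℝ (Fin n)) η := by
    intro y hy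
    have hpos : 0 < ‖y‖ := by linarith
    rw [mem_ball_zero_iff, Psi_norm hR hη (norm_pos_iff.1 hpos)]
    calc _ < phi k R η s0 := phi_anti hR hη hy
      _ = η := e0
  rw [integral_eq_lintegral_of_nonneg_ae, integral_eq_lintegral_of_nonneg_ae]
  rotate_left
  · filter_upwards [ae_restrict_mem hS] with y hy
    have := f0 _ (hmem y hy)
    have := phi_pos (k := k) hR hη ‖y‖
    have := Pe_pos k ‖y‖
    simp only [Pi.zero_apply]
    positivity
  · refine Measurable.aestronglyMeasurable ?_
    have := hf.comp hPsi
    simp only [Function.comp_def] at this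
    fun_prop
  · filter_upwards [ae_restrict_mem Metric.isOpen_ball.measurableSet] with y hy
    have := f0 _ hy
    simp only [Pi.zero_apply]
    positivity
  · refine Measurable.aestronglyMeasurable ?_
    fun_prop
  congr 1
  have key := cov hn (F := fun x => ENNReal.ofReal (f x)) hf.ennreal_ofReal (φ := phi k R η)
    (φ' := fun s => -(phi k R η s * Pe k s)) (s0 := s0) (η := η) (by linarith) hphi
    (by fun_prop) (fun s _ => phi_hasDerivAt s) (phi_anti hR hη).injective.injOn
    (phi_image hR hη h1 hs0)
  refine Eq.trans ?_ (key.trans ?_)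
  · refine setLIntegral_congr_fun Metric.isOpen_ball.measurableSet fun x hx => ?_
    exact ENNReal.ofReal_mul (f0 x hx)
  · refine setLIntegral_congr_fun hS fun y hy => ?_
    have a1 := f0 _ (hmem y hy)
    have a2 := phi_pos (k := k) hR hη ‖y‖
    have a3 := Pe_pos k ‖y‖
    have a4 : 0 < phi k R η ‖y‖ * Pe k ‖y‖ := by positivity
    show _ * ENNReal.ofReal (f (Psi n k R η y)) * _ = _
    rw [abs_neg, abs_of_pos a4, ← ENNReal.ofReal_mul a4.le, ← ENNReal.ofReal_mul (by positivity)]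

lemma log_iter_meas (j : ℕ) : Measurable (Real.log^[j]) := Real.measurable_log.iterate j

lemma wlog_meas : Measurable (fun x : EuclideanSpace ℝ (Fin n) => wlog k 1 R η ‖x‖) := by
  unfold wlog
  have hq : Measurable (fun x : EuclideanSpace ℝ (Fin n) => R * η / ‖x‖) :=
    measurable_const.div measurable_norm
  refine (measurable_norm.mul ?_).mul (((log_iter_meas k).comp hq).pow_const _)
  exact Finset.measurable_prod _ fun j _ => (log_iter_meas j).comp hq

lemma ball_phi (hR : 0 < R) (hη : 0 < η) (h1 : 1 < s0) (hs0 : Real.exp^[k + 1] s0 = R)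
    {x : EuclideanSpace ℝ (Fin n)} (hx : x ∈ Metric.ball (0 : EuclideanSpace ℝ (Fin n)) η)
    (hx0 : x ≠ 0) : ∃ s, s0 < s ∧ phi k R η s = ‖x‖ := by
  have : ‖x‖ ∈ Ioo 0 η := ⟨norm_pos_iff.2 hx0, by simpa using hx⟩
  rw [← phi_image (k := k) hR hη h1 hs0] at this
  exact this

lemma wlog_nonneg (hk : 1 ≤ k) (hR : 0 < R) (hη : 0 < η) (h1 : 1 < s0)
    (hs0 : Real.exp^[k + 1] s0 = R)
    {x : EuclideanSpace ℝ (Fin n)} (hx : x ∈ Metric.ball (0 : EuclideanSpace ℝ (Fin n)) η) :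
    0 ≤ wlog k 1 R η ‖x‖ ∧ (x ≠ 0 → 0 ≤ Real.log^[k + 1] (R * η / ‖x‖)) := by
  by_cases hx0 : x = 0
  · simp [hx0, wlog]
  · obtain ⟨s, hs, he⟩ := ball_phi hR hη h1 hs0 hx hx0
    rw [← he, wlog_phi hk hR hη, phi_inv hR hη, log_ex le_rfl]
    refine ⟨(mul_pos (phi_pos hR hη s) (Pe_pos k s)).le, fun _ => ?_⟩
    simp
    linarith

lemma lhs_bound (hn : 1 ≤ n) (hk : 1 ≤ k) {p : ℝ} (hp : 1 < p)
    (hR : 0 < R) (hη : 0 < η) (h1 : 1 < s0) (hs0 : Real.exp^[k + 1] s0 = R)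
    {u : EuclideanSpace ℝ (Fin n) → ℝ} (hu : ContDiff ℝ (⊤ : ℕ∞) u)
    (hf : tsupport u ⊆ Metric.ball 0 η \ {0}) :
    EN p (fun y => u (Psi n k R η y)) ≤ 3 ^ p *
      ∫ x in Metric.ball (0 : EuclideanSpace ℝ (Fin n)) η,
        ‖fderiv ℝ u x‖ ^ p * (wlog k 1 R η ‖x‖) ^ (p - 1) * ‖x‖ ^ (1 - (n : ℝ)) := by
  have hp0 : 0 < p := by linarith
  have hS : MeasurableSet {y : EuclideanSpace ℝ (Fin n) | s0 < ‖y‖} :=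
    measurableSet_lt measurable_const measurable_norm
  have hu1 : ContDiff ℝ 1 u := hu.of_le (by exact_mod_cast le_top)
  have hDc : Continuous (fderiv ℝ u) := hu1.continuous_fderiv one_ne_zero
  have hDf : tsupport (fderiv ℝ u) ⊆ Metric.ball 0 η \ {0} := (tsupport_fderiv_subset ℝ).trans hf
  have hg := good_comp hu hR hη h1 hs0 hf
  rw [covR hn hR hη h1 hs0 (f := fun x => ‖fderiv ℝ u x‖ ^ p * (wlog k 1 R η ‖x‖) ^ (p - 1))
    ((hDc.measurable.norm.pow_const _).mul (wlog_meas.pow_const _))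
    (fun x hx => mul_nonneg (by positivity) (Real.rpow_nonneg (wlog_nonneg hk hR hη h1 hs0 hx).1 _))]
  set g : EuclideanSpace ℝ (Fin n) → ℝ := fun y =>
    (‖fderiv ℝ u (Psi n k R η y)‖ * (phi k R η ‖y‖ * Pe k ‖y‖)) ^ p * ‖y‖ ^ (1 - (n:ℝ)) with hgdef
  have hcong : ∫ y in {y : EuclideanSpace ℝ (Fin n) | s0 < ‖y‖},
      (phi k R η ‖y‖ * Pe k ‖y‖) * (‖fderiv ℝ u (Psi n k R η y)‖ ^ p *
        (wlog k 1 R η ‖Psi n k R η y‖) ^ (p - 1)) * ‖y‖ ^ (1 - (n:ℝ)) =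
      ∫ y in {y : EuclideanSpace ℝ (Fin n) | s0 < ‖y‖}, g y := by
    refine setIntegral_congr_fun hS fun y hy => ?_
    have hpos : 0 < ‖y‖ := lt_trans (by linarith) hy
    have a4 : 0 < phi k R η ‖y‖ * Pe k ‖y‖ := mul_pos (phi_pos hR hη _) (Pe_pos k _)
    simp only [hgdef]
    rw [Psi_norm hR hη (norm_pos_iff.1 hpos), wlog_phi hk hR hη,
      Real.mul_rpow (norm_nonneg _) a4.le, Real.rpow_sub_one a4.ne']
    generalize phi k R η ‖y‖ * Pe k ‖y‖ = W at *
    field_simp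
  have hgz : ∀ y, ‖y‖ ≤ s0 → g y = 0 := by
    intro y hy
    simp [hgdef, comp_zero hR hη hs0 hDf hy, Real.zero_rpow hp0.ne']
  have hgi : Integrable g := by
    refine Continuous.integrable_of_hasCompactSupport ?_ ?_
    · rw [continuous_iff_continuousAt]
      intro y
      by_cases hy : y = 0
      · subst hy
        refine (continuousAt_const (y := (0:ℝ))).congr ?_
        filter_upwards [comp_near hR hη h1 hs0 hDf] with y hy
        have hy' : fderiv ℝ u (Psi n k R η y) = 0 := hy
        simp [hgdef, hy', Real.zero_rpow hp0.ne']
      · have c1 : ContinuousAt (fun y => fderiv ℝ u (Psi n k R η y)) y :=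
          hDc.continuousAt.comp (Psi_cd hy).continuousAt
        have c2 : Continuous (fun y : EuclideanSpace ℝ (Fin n) => phi k R η ‖y‖ * Pe k ‖y‖) :=
          (phi_contDiff.continuous.comp continuous_norm).mul ((Pe_cont k).comp continuous_norm)
        refine ContinuousAt.mul ((c1.norm.mul c2.continuousAt).rpow_const (Or.inr hp0.le)) ?_
        exact continuous_norm.continuousAt.rpow_const (Or.inl (by simpa using hy))
    · refine (comp_cs (k := k) hR hη hDf).mono ?_
      intro y hy
      contrapose! hy
      simp only [Function.mem_support, not_not] at hy ⊢
      simp [hgdef, hy, Real.zero_rpow hp0.ne']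
  rw [hcong, setIntegral_eq_integral_of_forall_compl_eq_zero
    (s := {y : EuclideanSpace ℝ (Fin n) | s0 < ‖y‖}) (fun y hy => hgz y (not_lt.1 hy)), ← integral_const_mul]
  unfold EN
  refine integral_mono_of_nonneg (Eventually.of_forall fun y => by positivity)
    (hgi.const_mul _) (Eventually.of_forall fun y => ?_)
  show _ ≤ 3 ^ p * ((‖fderiv ℝ u (Psi n k R η y)‖ * (phi k R η ‖y‖ * Pe k ‖y‖)) ^ p *
    ‖y‖ ^ (1 - (n:ℝ)))
  have a4 : 0 < phi k R η ‖y‖ * Pe k ‖y‖ := mul_pos (phi_pos hR hη _) (Pe_pos k _)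
  rw [← mul_assoc, ← Real.mul_rpow (by norm_num) (by positivity)]
  refine mul_le_mul_of_nonneg_right (Real.rpow_le_rpow (norm_nonneg _) ?_ hp0.le) (by positivity)
  by_cases hy : y = 0
  · have : fderiv ℝ (fun y => u (Psi n k R η y)) y = 0 := by
      rw [hy]; exact hg.dz.eq_of_nhds
    rw [this, norm_zero]; positivity
  have hch : fderiv ℝ (fun y => u (Psi n k R η y)) y =
      (fderiv ℝ u (Psi n k R η y)).comp (fderiv ℝ (Psi n k R η) y) :=
    fderiv_comp y (hu1.differentiable one_ne_zero _) ((Psi_cd hy).differentiableAt one_ne_zero)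
  rw [hch]
  by_cases hys : ‖y‖ ≤ s0
  · rw [comp_zero hR hη hs0 hDf hys]
    simp
  · have := Psi_fderiv (k := k) hR hη (y := y) (by linarith)
    calc _ ≤ ‖fderiv ℝ u (Psi n k R η y)‖ * ‖fderiv ℝ (Psi n k R η) y‖ :=
          ContinuousLinearMap.opNorm_comp_le _ _
      _ ≤ ‖fderiv ℝ u (Psi n k R η y)‖ * (3 * (phi k R η ‖y‖ * Pe k ‖y‖)) := by gcongr
      _ = _ := by ring

lemma rhs_bound (hn : 1 ≤ n) (hk : 1 ≤ k) {p q : ℝ} (hp : 1 < p) (hq : 0 < q)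
    (hR : 0 < R) (hη : 0 < η) (h1 : 1 < s0) (hs0 : Real.exp^[k + 1] s0 = R)
    {u : EuclideanSpace ℝ (Fin n) → ℝ} (hu : ContDiff ℝ (⊤ : ℕ∞) u)
    (hf : tsupport u ⊆ Metric.ball 0 η \ {0}) :
    0 ≤ ∫ x in Metric.ball (0 : EuclideanSpace ℝ (Fin n)) η,
            |u x| ^ q * ‖x‖ ^ (1 - (n : ℝ)) /
              (wlog k 1 R η ‖x‖ *
                (Real.log^[k + 1] (R * η / ‖x‖)) ^
                  (1 + q / (p / (p - 1)))) ∧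
    ∫ x in Metric.ball (0 : EuclideanSpace ℝ (Fin n)) η,
            |u x| ^ q * ‖x‖ ^ (1 - (n : ℝ)) /
              (wlog k 1 R η ‖x‖ *
                (Real.log^[k + 1] (R * η / ‖x‖)) ^
                  (1 + q / (p / (p - 1)))) ≤ IQ p q (fun y => u (Psi n k R η y)) := by
  have hS : MeasurableSet {y : EuclideanSpace ℝ (Fin n) | s0 < ‖y‖} :=
    measurableSet_lt measurable_const measurable_norm
  have hg := good_comp hu hR hη h1 hs0 hf
  set f : EuclideanSpace ℝ (Fin n) → ℝ := fun x => |u x| ^ q / (wlog k 1 R η ‖x‖ *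
                (Real.log^[k + 1] (R * η / ‖x‖)) ^ (1 + q / (p / (p - 1)))) with hfdef
  have e1 : ∀ x : EuclideanSpace ℝ (Fin n), |u x| ^ q * ‖x‖ ^ (1 - (n : ℝ)) /
              (wlog k 1 R η ‖x‖ * (Real.log^[k + 1] (R * η / ‖x‖)) ^
                  (1 + q / (p / (p - 1)))) = f x * ‖x‖ ^ (1 - (n : ℝ)) := by
    intro x; simp only [hfdef]; ring
  have f0 : ∀ x ∈ Metric.ball (0 : EuclideanSpace ℝ (Fin n)) η, 0 ≤ f x := by
    intro x hx
    obtain ⟨b1, b2⟩ := wlog_nonneg hk hR hη h1 hs0 hx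
    by_cases hx0 : x = 0
    · simp [hfdef, hx0, wlog]
    · exact div_nonneg (by positivity) (mul_nonneg b1 (Real.rpow_nonneg (b2 hx0) _))
  simp only [e1]
  refine ⟨setIntegral_nonneg Metric.isOpen_ball.measurableSet fun x hx =>
    mul_nonneg (f0 x hx) (by positivity), ?_⟩
  have hfm : Measurable f := by
    refine Measurable.div (hu.continuous.abs.measurable.pow_const _) (wlog_meas.mul ?_)
    exact ((log_iter_meas (k + 1)).comp (measurable_const.div measurable_norm)).pow_const _
  rw [covR hn hR hη h1 hs0 hfm f0]
  have hcong : ∫ y in {y : EuclideanSpace ℝ (Fin n) | s0 < ‖y‖},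
      (phi k R η ‖y‖ * Pe k ‖y‖) * f (Psi n k R η y) * ‖y‖ ^ (1 - (n:ℝ)) =
      ∫ y in {y : EuclideanSpace ℝ (Fin n) | s0 < ‖y‖},
        |u (Psi n k R η y)| ^ q * ‖y‖ ^ (-((p - 1) / p * q) - n) := by
    refine setIntegral_congr_fun hS fun y hy => ?_
    have hpos : 0 < ‖y‖ := lt_trans (by linarith) hy
    have a4 : 0 < phi k R η ‖y‖ * Pe k ‖y‖ := mul_pos (phi_pos hR hη _) (Pe_pos k _)
    simp only [hfdef]
    rw [Psi_norm hR hη (norm_pos_iff.1 hpos), wlog_phi hk hR hη, phi_inv hR hη, log_ex le_rfl,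
      Nat.sub_self, Function.iterate_zero_apply]
    have e2 : -((p - 1) / p * q) - (n:ℝ) = (1 - (n:ℝ)) - (1 + q / (p / (p - 1))) := by
      have : p - 1 ≠ 0 := by linarith
      field_simp
      ring
    rw [e2, Real.rpow_sub hpos (1 - (n:ℝ))]
    have := Real.rpow_pos_of_pos hpos (1 + q / (p / (p - 1)))
    generalize ‖y‖ ^ (1 + q / (p / (p - 1))) = Z at *
    generalize phi k R η ‖y‖ * Pe k ‖y‖ = W at *
    field_simp
  rw [hcong]
  exact setIntegral_le_integral (wp_int hg hq _) (Eventually.of_forall fun y => by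
    simp only [Pi.zero_apply]; positivity)

end main

/-- Critical CKN-type inequality with poly-logarithmic weights, critical exponent
`α = 1`: for `n, k ≥ 1`, `1 < p ≤ q < ∞` with `0 ≤ 1/p − 1/q ≤ 1/n`, `η > 0` and
`R > exp^{k+1}(1)`, there is `C > 0` such that for all `u ∈ C_c^∞(B_η∖{0})`,
`∫_{B_η} |∇u|^p w_{k,1}(|x|)^{p−1} |x|^{1−n} ≥
 C (∫_{B_η} |u|^q |x|^{1−n} / (w_{k,1}(|x|)·(log^{k+1}(Rη/|x|))^{1+q/p'}))^{p/q}`. -/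
theorem stmt15 (n k : ℕ) (hn : 1 ≤ n) (hk : 1 ≤ k) (p q : ℝ) (hp : 1 < p) (hpq : p ≤ q)
    (h1 : 0 ≤ 1 / p - 1 / q) (h2 : 1 / p - 1 / q ≤ 1 / (n : ℝ))
    (η : ℝ) (hη : 0 < η) (R : ℝ) (hR : Real.exp^[k + 1] 1 < R) :
    ∃ C : ℝ, 0 < C ∧ ∀ u : EuclideanSpace ℝ (Fin n) → ℝ,
      ContDiff ℝ (⊤ : ℕ∞) u → HasCompactSupport u →
      tsupport u ⊆ Metric.ball 0 η \ {0} →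
      ∫ x in Metric.ball (0 : EuclideanSpace ℝ (Fin n)) η,
          ‖fderiv ℝ u x‖ ^ p * (wlog k 1 R η ‖x‖) ^ (p - 1) * ‖x‖ ^ (1 - (n : ℝ)) ≥
        C * (∫ x in Metric.ball (0 : EuclideanSpace ℝ (Fin n)) η,
            |u x| ^ q * ‖x‖ ^ (1 - (n : ℝ)) /
              (wlog k 1 R η ‖x‖ *
                (Real.log^[k + 1] (R * η / ‖x‖)) ^
                  (1 + q / (p / (p - 1))))) ^ (p / q) := by
  have hR0 : 0 < R := lt_of_lt_of_le zero_lt_one ((ex_ge (k + 1) 1).trans hR.le)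
  obtain ⟨s0, hs1, hs0⟩ := ex_surj (k + 1) hR
  obtain ⟨C, hC, hckn⟩ := ckn (n := n) hn hp hpq h2
  have hp0 : 0 < p := by linarith
  have hq0 : 0 < q := by linarith
  refine ⟨(C ^ (p / q) * 3 ^ p)⁻¹, by positivity, fun u hu _ hf => ?_⟩
  have hL := lhs_bound hn hk hp hR0 hη hs1 hs0 hu hf
  obtain ⟨hr0, hr⟩ := rhs_bound hn hk hp hq0 hR0 hη hs1 hs0 hu hf
  have hc := hckn _ (good_comp hu hR0 hη hs1 hs0 hf)
  have hE := EN_nonneg p (fun y => u (Psi n k R η y))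
  rw [ge_iff_le, inv_mul_le_iff₀ (by positivity)]
  calc _ ≤ (C * EN p (fun y => u (Psi n k R η y)) ^ (q / p)) ^ (p / q) :=
        Real.rpow_le_rpow hr0 (hr.trans hc) (by positivity)
    _ = C ^ (p / q) * EN p (fun y => u (Psi n k R η y)) := by
        rw [Real.mul_rpow hC.le (by positivity), ← Real.rpow_mul hE]
        have : q / p * (p / q) = 1 := by field_simp
        rw [this, Real.rpow_one]
    _ ≤ _ := by
        rw [mul_assoc]
        gcongr
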